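/- Let A = 𝕜[x] and B = 𝕜[y] and let τ: B⊗A → A⊗B be a graded twisting map with τ(y⊗x) = a x²⊗1 + b x⊗y + c 1⊗y² for scalars a, b, c ∈ 𝕜. If 1 − ac ≠ 0, then τ has the unique extension property and A⊗_τB is τ-quadratic. -/

import Mathlib

open TensorProduct

noncomputable section

namespace TTP

variable (𝕜 : Type) [Field 𝕜]

/-- The image of `p ⊗ q` inside `M ⊗[𝕜] N`, for submodules `p ⊆ M`, `q ⊆ N`. -/
def subTmul {M N : Type} [AddCommGroup M] [Module 𝕜 M] [AddCommGroup N] [Module 𝕜 N]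
    (p : Submodule 𝕜 M) (q : Submodule 𝕜 N) : Submodule 𝕜 (M ⊗[𝕜] N) :=
  LinearMap.range (TensorProduct.map p.subtype q.subtype)

/-- The Künneth grading on a tensor product of graded vector spaces. -/
def kunneth {M N : Type} [AddCommGroup M] [Module 𝕜 M] [AddCommGroup N] [Module 𝕜 N]
    (𝒜 : ℕ → Submodule 𝕜 M) (ℬ : ℕ → Submodule 𝕜 N) (n : ℕ) : Submodule 𝕜 (M ⊗[𝕜] N) :=
  ⨆ (pq : ℕ × ℕ) (_ : pq.1 + pq.2 = n), subTmul 𝕜 (𝒜 pq.1) (ℬ pq.2)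

/-- The positive part `X₊ = ⊕_{i>0} X_i` of a graded vector space. -/
def plusPart {M : Type} [AddCommGroup M] [Module 𝕜 M] (𝒜 : ℕ → Submodule 𝕜 M) :
    Submodule 𝕜 M :=
  ⨆ (i : ℕ) (_ : 0 < i), 𝒜 i

/-- The grading concentrating `𝒜 1` in degree `1` (and `⊥` elsewhere). -/
def degOne {M : Type} [AddCommGroup M] [Module 𝕜 M] (𝒜 : ℕ → Submodule 𝕜 M) :
    ℕ → Submodule 𝕜 M :=
  fun n => if n = 1 then 𝒜 1 else ⊥

variable (A B : Type) [Ring A] [Algebra 𝕜 A] [Ring B] [Algebra 𝕜 B]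

/-- `τ ∘ (μ_B ⊗ μ_A)` on `(B ⊗ B) ⊗ (A ⊗ A)`. -/
def twistLHS (τ : B ⊗[𝕜] A →ₗ[𝕜] A ⊗[𝕜] B) :
    (B ⊗[𝕜] B) ⊗[𝕜] (A ⊗[𝕜] A) →ₗ[𝕜] A ⊗[𝕜] B :=
  τ ∘ₗ TensorProduct.map (LinearMap.mul' 𝕜 B) (LinearMap.mul' 𝕜 A)

/-- `(μ_A ⊗ μ_B) ∘ (1_A ⊗ τ ⊗ 1_B) ∘ (τ ⊗ τ) ∘ (1_B ⊗ τ ⊗ 1_A)` on `(B ⊗ B) ⊗ (A ⊗ A)`. -/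
def twistRHS (τ : B ⊗[𝕜] A →ₗ[𝕜] A ⊗[𝕜] B) :
    (B ⊗[𝕜] B) ⊗[𝕜] (A ⊗[𝕜] A) →ₗ[𝕜] A ⊗[𝕜] B :=
  TensorProduct.map (LinearMap.mul' 𝕜 A) (LinearMap.mul' 𝕜 B)
    ∘ₗ (TensorProduct.assoc 𝕜 A A (B ⊗[𝕜] B)).symm.toLinearMap
    ∘ₗ LinearMap.lTensor A (TensorProduct.assoc 𝕜 A B B).toLinearMap
    ∘ₗ LinearMap.lTensor A (LinearMap.rTensor B τ)
    ∘ₗ LinearMap.lTensor A (TensorProduct.assoc 𝕜 B A B).symm.toLinearMap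
    ∘ₗ (TensorProduct.assoc 𝕜 A B (A ⊗[𝕜] B)).toLinearMap
    ∘ₗ TensorProduct.map τ τ
    ∘ₗ (TensorProduct.assoc 𝕜 B A (B ⊗[𝕜] A)).symm.toLinearMap
    ∘ₗ LinearMap.lTensor B (TensorProduct.assoc 𝕜 A B A).toLinearMap
    ∘ₗ LinearMap.lTensor B (LinearMap.rTensor A τ)
    ∘ₗ LinearMap.lTensor B (TensorProduct.assoc 𝕜 B A A).symm.toLinearMap
    ∘ₗ (TensorProduct.assoc 𝕜 B B (A ⊗[𝕜] A)).toLinearMap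

/-- `τ : B ⊗ A → A ⊗ B` is an (algebra) twisting map: it satisfies the unital twisting
conditions and `τ(μ_B ⊗ μ_A) = (μ_A ⊗ μ_B)(1_A ⊗ τ ⊗ 1_B)(τ ⊗ τ)(1_B ⊗ τ ⊗ 1_A)`. -/
def IsTwisting (τ : B ⊗[𝕜] A →ₗ[𝕜] A ⊗[𝕜] B) : Prop :=
  (∀ a : A, τ ((1 : B) ⊗ₜ[𝕜] a) = a ⊗ₜ[𝕜] (1 : B)) ∧
  (∀ b : B, τ (b ⊗ₜ[𝕜] (1 : A)) = (1 : A) ⊗ₜ[𝕜] b) ∧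
  twistLHS 𝕜 A B τ = twistRHS 𝕜 A B τ

/-- `τ` preserves the Künneth grading. -/
def IsGradedMapBA (𝒜 : ℕ → Submodule 𝕜 A) (ℬ : ℕ → Submodule 𝕜 B)
    (τ : B ⊗[𝕜] A →ₗ[𝕜] A ⊗[𝕜] B) : Prop :=
  ∀ n, Submodule.map τ (kunneth 𝕜 ℬ 𝒜 n) ≤ kunneth 𝕜 𝒜 ℬ n

/-- `τ` is a graded twisting map. -/
def IsGradedTwisting (𝒜 : ℕ → Submodule 𝕜 A) (ℬ : ℕ → Submodule 𝕜 B)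
    (τ : B ⊗[𝕜] A →ₗ[𝕜] A ⊗[𝕜] B) : Prop :=
  IsTwisting 𝕜 A B τ ∧ IsGradedMapBA 𝕜 A B 𝒜 ℬ τ

/-- A graded linear map `τ` is graded twisting to degree `n`:  it satisfies the unital
conditions and the twisting identity in all (Künneth) degrees `≤ n`. -/
def TwistingToDeg (𝒜 : ℕ → Submodule 𝕜 A) (ℬ : ℕ → Submodule 𝕜 B)
    (τ : B ⊗[𝕜] A →ₗ[𝕜] A ⊗[𝕜] B) (n : ℕ) : Prop :=
  IsGradedMapBA 𝕜 A B 𝒜 ℬ τ ∧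
  (∀ j ≤ n, ∀ a ∈ 𝒜 j, τ ((1 : B) ⊗ₜ[𝕜] a) = a ⊗ₜ[𝕜] (1 : B)) ∧
  (∀ j ≤ n, ∀ b ∈ ℬ j, τ (b ⊗ₜ[𝕜] (1 : A)) = (1 : A) ⊗ₜ[𝕜] b) ∧
  (∀ j ≤ n, ∀ x ∈ kunneth 𝕜 (kunneth 𝕜 ℬ ℬ) (kunneth 𝕜 𝒜 𝒜) j,
    twistLHS 𝕜 A B τ x = twistRHS 𝕜 A B τ x)

/-- The unique extension property of a graded twisting map:  for every `n ≥ 3`, any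
linear map `τ'` that is graded twisting to degree `n` and agrees with `τ` in all degrees
`< n` also agrees with `τ` in degree `n`. -/
def UEP (𝒜 : ℕ → Submodule 𝕜 A) (ℬ : ℕ → Submodule 𝕜 B)
    (τ : B ⊗[𝕜] A →ₗ[𝕜] A ⊗[𝕜] B) : Prop :=
  ∀ n, 3 ≤ n → ∀ τ' : B ⊗[𝕜] A →ₗ[𝕜] A ⊗[𝕜] B,
    TwistingToDeg 𝕜 A B 𝒜 ℬ τ' n →
    (∀ i < n, ∀ x ∈ kunneth 𝕜 ℬ 𝒜 i, τ' x = τ x) →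
    ∀ x ∈ kunneth 𝕜 ℬ 𝒜 n, τ' x = τ x

/-- The multiplication `μ_τ = (μ_A ⊗ μ_B)(1_A ⊗ τ ⊗ 1_B)` on `A ⊗ B`. -/
def mulTau (τ : B ⊗[𝕜] A →ₗ[𝕜] A ⊗[𝕜] B) :
    (A ⊗[𝕜] B) ⊗[𝕜] (A ⊗[𝕜] B) →ₗ[𝕜] A ⊗[𝕜] B :=
  TensorProduct.map (LinearMap.mul' 𝕜 A) (LinearMap.mul' 𝕜 B)
    ∘ₗ (TensorProduct.assoc 𝕜 A A (B ⊗[𝕜] B)).symm.toLinearMap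
    ∘ₗ LinearMap.lTensor A (TensorProduct.assoc 𝕜 A B B).toLinearMap
    ∘ₗ LinearMap.lTensor A (LinearMap.rTensor B τ)
    ∘ₗ LinearMap.lTensor A (TensorProduct.assoc 𝕜 B A B).symm.toLinearMap
    ∘ₗ (TensorProduct.assoc 𝕜 A B (A ⊗[𝕜] B)).toLinearMap

/-- `(C, ψ)` realizes the twisted tensor product algebra `A ⊗_τ B`:  `ψ` is a linear
isomorphism carrying the multiplication `μ_τ` and its unit to those of `C`. -/
def Realizes (τ : B ⊗[𝕜] A →ₗ[𝕜] A ⊗[𝕜] B) (C : Type) [Ring C] [Algebra 𝕜 C]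
    (ψ : A ⊗[𝕜] B →ₗ[𝕜] C) : Prop :=
  Function.Bijective ψ ∧ ψ ((1 : A) ⊗ₜ[𝕜] (1 : B)) = 1 ∧
  ∀ x y : A ⊗[𝕜] B, ψ (mulTau 𝕜 A B τ (x ⊗ₜ[𝕜] y)) = ψ x * ψ y

/-- The two-sided ideal generated by a subset, as a `𝕜`-submodule. -/
def idealSpan (C : Type) [Ring C] [Algebra 𝕜 C] (s : Set C) : Submodule 𝕜 C :=
  Submodule.span 𝕜 {x | ∃ c d r, r ∈ s ∧ x = c * r * d}

/-- Weight grading of the tensor algebra. -/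
def tensorWeight (V : Type) [AddCommGroup V] [Module 𝕜 V] (n : ℕ) :
    Submodule 𝕜 (TensorAlgebra 𝕜 V) :=
  LinearMap.range (TensorAlgebra.ι 𝕜 (M := V)) ^ n

instance (V : Type) [AddCommGroup V] [Module 𝕜 V] : GradedAlgebra (tensorWeight 𝕜 V) :=
  inferInstanceAs (GradedAlgebra
    ((LinearMap.range (TensorAlgebra.ι 𝕜 : V →ₗ[𝕜] TensorAlgebra 𝕜 V) ^ ·) : ℕ → Submodule 𝕜 _))

/-- The canonical map `T(C₁) → C` for a graded algebra `C`. -/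
def canMap (C : Type) [Ring C] [Algebra 𝕜 C] (𝒞 : ℕ → Submodule 𝕜 C) :
    TensorAlgebra 𝕜 ↥(𝒞 1) →ₐ[𝕜] C :=
  TensorAlgebra.lift 𝕜 (𝒞 1).subtype

/-- `C` (with grading `𝒞`) is a quadratic algebra: the canonical map `T(C₁) → C` is
surjective and its kernel is generated, as a two-sided ideal, by its degree 2 part. -/
def IsQuadraticAlg (C : Type) [Ring C] [Algebra 𝕜 C] (𝒞 : ℕ → Submodule 𝕜 C) : Prop :=
  Function.Surjective (canMap 𝕜 C 𝒞) ∧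
  LinearMap.ker (canMap 𝕜 C 𝒞).toLinearMap =
    idealSpan 𝕜 (TensorAlgebra 𝕜 ↥(𝒞 1))
      ((LinearMap.ker (canMap 𝕜 C 𝒞).toLinearMap ⊓ tensorWeight 𝕜 ↥(𝒞 1) 2 : Submodule 𝕜 _) : Set _)

/-- The left ideal generated by the positive part of a graded algebra. -/
def augIdeal (C : Type) [Ring C] [Algebra 𝕜 C] (𝒞 : ℕ → Submodule 𝕜 C) : Submodule C C :=
  Submodule.span C {x : C | ∃ i, 0 < i ∧ x ∈ 𝒞 i}

/-- The degree `n` component of the graded free module on generators `σ` in degree `i`. -/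
def freeGrade (C : Type) [Ring C] [Algebra 𝕜 C] (𝒞 : ℕ → Submodule 𝕜 C)
    (i : ℕ) (σ : Type) (n : ℕ) : Submodule 𝕜 (σ →₀ C) :=
  ⨅ (j : σ), Submodule.comap (Finsupp.lapply j : (σ →₀ C) →ₗ[𝕜] C)
    (if i ≤ n then 𝒞 (n - i) else ⊥)

/-- `C` (with grading `𝒞`) is a Koszul algebra: the trivial module `𝕜 = C/C₊` admits a
resolution by graded free modules with the `i`-th term generated in degree `i`. -/
def IsKoszul (C : Type) [Ring C] [Algebra 𝕜 C] (𝒞 : ℕ → Submodule 𝕜 C) : Prop :=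
  ∃ (σ : ℕ → Type) (d : ∀ i : ℕ, ((σ (i + 1)) →₀ C) →ₗ[C] ((σ i) →₀ C))
    (ε : ((σ 0) →₀ C) →ₗ[C] (C ⧸ augIdeal 𝕜 C 𝒞)),
    Function.Surjective ε ∧
    LinearMap.ker ε = LinearMap.range (d 0) ∧
    (∀ i, LinearMap.ker (d i) = LinearMap.range (d (i + 1))) ∧
    (∀ i n, ∀ x ∈ freeGrade 𝕜 C 𝒞 (i + 1) (σ (i + 1)) n, d i x ∈ freeGrade 𝕜 C 𝒞 i (σ i) n) ∧
    (∀ n, 0 < n → ∀ x ∈ freeGrade 𝕜 C 𝒞 0 (σ 0) n, ε x = 0)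

/-- `(P, ιA, ιB)` is a free product (coproduct) of `A` and `B`. -/
def IsFreeProduct (P : Type) [Ring P] [Algebra 𝕜 P] (ιA : A →ₐ[𝕜] P) (ιB : B →ₐ[𝕜] P) :
    Prop :=
  ∀ (C : Type) [Ring C] [Algebra 𝕜 C], ∀ (f : A →ₐ[𝕜] C) (g : B →ₐ[𝕜] C),
    ∃! h : P →ₐ[𝕜] C, h.comp ιA = f ∧ h.comp ιB = g

/-- The linear map `A ⊗ B → P`, `a ⊗ b ↦ ιA(a) · ιB(b)`. -/
def mulMapP (P : Type) [Ring P] [Algebra 𝕜 P] (ιA : A →ₐ[𝕜] P) (ιB : B →ₐ[𝕜] P) :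
    A ⊗[𝕜] B →ₗ[𝕜] P :=
  TensorProduct.lift (LinearMap.mk₂ 𝕜 (fun a b => ιA a * ιB b)
    (fun a a' b => by simp [map_add, add_mul])
    (fun c a b => by simp [map_smul, smul_mul_assoc])
    (fun a b b' => by simp [map_add, mul_add])
    (fun c a b => by simp [map_smul, mul_smul_comm]))

/-- The set of `τ`-relations `b ⊗ a - τ(b ⊗ a)` of total degree at most `n`,
inside the free product `P`. -/
def relSetLe (P : Type) [Ring P] [Algebra 𝕜 P] (ιA : A →ₐ[𝕜] P) (ιB : B →ₐ[𝕜] P)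
    (𝒜 : ℕ → Submodule 𝕜 A) (ℬ : ℕ → Submodule 𝕜 B)
    (τ : B ⊗[𝕜] A →ₗ[𝕜] A ⊗[𝕜] B) (n : ℕ) : Set P :=
  {x | ∃ i j a b, i + j ≤ n ∧ a ∈ 𝒜 i ∧ b ∈ ℬ j ∧
    x = ιB b * ιA a - mulMapP 𝕜 A B P ιA ιB (τ (b ⊗ₜ[𝕜] a))}

/-- The set of all `τ`-relations `b ⊗ a - τ(b ⊗ a)` inside the free product `P`. -/
def relSetAll (P : Type) [Ring P] [Algebra 𝕜 P] (ιA : A →ₐ[𝕜] P) (ιB : B →ₐ[𝕜] P)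
    (τ : B ⊗[𝕜] A →ₗ[𝕜] A ⊗[𝕜] B) : Set P :=
  {x | ∃ a b, x = ιB b * ιA a - mulMapP 𝕜 A B P ιA ιB (τ (b ⊗ₜ[𝕜] a))}

/-- The (Künneth) grading on the free product `P` of the graded algebras `A` and `B`. -/
def freeProdGrade (P : Type) [Ring P] [Algebra 𝕜 P] (ιA : A →ₐ[𝕜] P) (ιB : B →ₐ[𝕜] P)
    (𝒜 : ℕ → Submodule 𝕜 A) (ℬ : ℕ → Submodule 𝕜 B) (n : ℕ) : Submodule 𝕜 P :=
  ⨆ (l : List ℕ) (_ : l.sum = n),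
    ((l.map (fun i => Submodule.map ιA.toLinearMap (𝒜 i) ⊔ Submodule.map ιB.toLinearMap (ℬ i))).foldr
      (· * ·) 1)

end TTP

namespace TTP

open Polynomial

/-- The grading of `𝕜[x]` by degree: the degree `n` component is spanned by `x^n`. -/
def polyGrade (𝕜 : Type) [Field 𝕜] : ℕ → Submodule 𝕜 (Polynomial 𝕜) :=
  fun n => Submodule.span 𝕜 {(X : Polynomial 𝕜) ^ n}

section Kunneth

variable {𝕜 : Type} [Field 𝕜]

lemma tmul_mem_kunneth {M N : Type} [AddCommGroup M] [Module 𝕜 M] [AddCommGroup N] [Module 𝕜 N]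
    {𝒜 : ℕ → Submodule 𝕜 M} {ℬ : ℕ → Submodule 𝕜 N} {i j : ℕ} {m : M} {n : N}
    (hm : m ∈ 𝒜 i) (hn : n ∈ ℬ j) : m ⊗ₜ[𝕜] n ∈ kunneth 𝕜 𝒜 ℬ (i + j) := by
  refine Submodule.mem_iSup_of_mem (i, j) (Submodule.mem_iSup_of_mem rfl ?_)
  exact ⟨(⟨m, hm⟩ : 𝒜 i) ⊗ₜ (⟨n, hn⟩ : ℬ j), rfl⟩

lemma X_pow_mem_polyGrade (n : ℕ) : (X : Polynomial 𝕜) ^ n ∈ polyGrade 𝕜 n :=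
  Submodule.mem_span_singleton_self _

lemma X_pow_tmul_mem_kunneth (i j : ℕ) :
    ((X : Polynomial 𝕜) ^ i) ⊗ₜ[𝕜] ((X : Polynomial 𝕜) ^ j) ∈
      kunneth 𝕜 (polyGrade 𝕜) (polyGrade 𝕜) (i + j) :=
  tmul_mem_kunneth (X_pow_mem_polyGrade i) (X_pow_mem_polyGrade j)

lemma kunneth_polyGrade_le {n : ℕ} {S : Submodule 𝕜 (Polynomial 𝕜 ⊗[𝕜] Polynomial 𝕜)}
    (hS : ∀ i j, i + j = n → ((X : Polynomial 𝕜) ^ i) ⊗ₜ[𝕜] ((X : Polynomial 𝕜) ^ j) ∈ S) :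
    kunneth 𝕜 (polyGrade 𝕜) (polyGrade 𝕜) n ≤ S := by
  refine iSup₂_le ?_
  rintro ⟨i, j⟩ hij z ⟨w, rfl⟩
  induction w with
  | zero => simp
  | add u v hu hv => rw [map_add]; exact S.add_mem hu hv
  | tmul p q =>
    obtain ⟨p, hp⟩ := p
    obtain ⟨q, hq⟩ := q
    obtain ⟨r, rfl⟩ := Submodule.mem_span_singleton.1 hp
    obtain ⟨s, rfl⟩ := Submodule.mem_span_singleton.1 hq
    simp only [TensorProduct.map_tmul, Submodule.subtype_apply, TensorProduct.smul_tmul',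
      TensorProduct.tmul_smul]
    exact S.smul_mem _ (S.smul_mem _ (hS i j hij))

/-- Evaluation of `𝕜[x] ⊗ 𝕜[y]` at `x = 0`, `y = 1`; on the degree `n` component it reads off
the coefficient of `1 ⊗ yⁿ`. -/
def evalZeroOne (𝕜 : Type) [Field 𝕜] : Polynomial 𝕜 ⊗[𝕜] Polynomial 𝕜 →ₐ[𝕜] 𝕜 :=
  Algebra.TensorProduct.lift (aeval 0) (aeval 1) (fun _ _ => Commute.all _ _)

@[simp]
lemma evalZeroOne_X_pow_tmul (i j : ℕ) :
    evalZeroOne 𝕜 (((X : Polynomial 𝕜) ^ i) ⊗ₜ[𝕜] ((X : Polynomial 𝕜) ^ j)) =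
      if i = 0 then 1 else 0 := by
  simp [evalZeroOne, zero_pow_eq]

lemma exists_eq_sum_of_mem_kunneth {n : ℕ} {w : Polynomial 𝕜 ⊗[𝕜] Polynomial 𝕜}
    (hw : w ∈ kunneth 𝕜 (polyGrade 𝕜) (polyGrade 𝕜) n) :
    ∃ t : ℕ → 𝕜, t n = evalZeroOne 𝕜 w ∧
      w = ∑ k ∈ Finset.range (n + 1),
        t k • (((X : Polynomial 𝕜) ^ (n - k)) ⊗ₜ[𝕜] ((X : Polynomial 𝕜) ^ k)) := by
  let S := LinearMap.range (∑ k ∈ Finset.range (n + 1),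
    (LinearMap.proj k : (ℕ → 𝕜) →ₗ[𝕜] 𝕜).smulRight
      (((X : Polynomial 𝕜) ^ (n - k)) ⊗ₜ[𝕜] ((X : Polynomial 𝕜) ^ k)))
  have hS : kunneth 𝕜 (polyGrade 𝕜) (polyGrade 𝕜) n ≤ S := by
    refine kunneth_polyGrade_le fun i j hij => ⟨Pi.single j 1, ?_⟩
    rw [LinearMap.sum_apply, Finset.sum_eq_single j]
    · simp [← hij]
    · intro k _ hk
      simp [hk]
    · intro hj
      simp at hj
      omega
  obtain ⟨t, rfl⟩ := hS hw
  refine ⟨t, ?_, by simp [LinearMap.sum_apply]⟩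
  rw [LinearMap.sum_apply, map_sum, Finset.sum_range_succ, Finset.sum_eq_zero]
  · simp [evalZeroOne]
  · intro k hk
    have : n - k ≠ 0 := by simp at hk; omega
    simp [-Algebra.TensorProduct.tmul_pow, this]

end Kunneth

section Twisting

variable {𝕜 : Type} [Field 𝕜]

lemma twistRHS_tmul {A B ι : Type} [Ring A] [Algebra 𝕜 A] [Ring B] [Algebra 𝕜 B]
    {τ : B ⊗[𝕜] A →ₗ[𝕜] A ⊗[𝕜] B} {b₁ b₂ : B} {a₁ a₂ : A} {s : Finset ι} {t : ι → 𝕜}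
    {u : ι → A} {v : ι → B} (h : τ (b₂ ⊗ₜ[𝕜] a₁) = ∑ k ∈ s, t k • (u k ⊗ₜ[𝕜] v k)) :
    twistRHS 𝕜 A B τ ((b₁ ⊗ₜ[𝕜] b₂) ⊗ₜ[𝕜] (a₁ ⊗ₜ[𝕜] a₂)) =
      ∑ k ∈ s, t k • mulTau 𝕜 A B τ (τ (b₁ ⊗ₜ[𝕜] u k) ⊗ₜ[𝕜] τ (v k ⊗ₜ[𝕜] a₂)) := by
  simp [twistRHS, mulTau, h, TensorProduct.sum_tmul, TensorProduct.tmul_sum,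
    ← TensorProduct.smul_tmul']

variable {τ τ' : Polynomial 𝕜 ⊗[𝕜] Polynomial 𝕜 →ₗ[𝕜] Polynomial 𝕜 ⊗[𝕜] Polynomial 𝕜} {n : ℕ}

lemma IsGradedTwisting.twistingToDeg {A B : Type} [Ring A] [Algebra 𝕜 A] [Ring B] [Algebra 𝕜 B]
    {𝒜 : ℕ → Submodule 𝕜 A} {ℬ : ℕ → Submodule 𝕜 B} {τ : B ⊗[𝕜] A →ₗ[𝕜] A ⊗[𝕜] B}
    (hτ : IsGradedTwisting 𝕜 A B 𝒜 ℬ τ) (n : ℕ) : TwistingToDeg 𝕜 A B 𝒜 ℬ τ n :=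
  ⟨hτ.2, fun _ _ a _ => hτ.1.1 a, fun _ _ b _ => hτ.1.2.1 b,
    fun _ _ x _ => LinearMap.congr_fun hτ.1.2.2 x⟩

namespace TwistingToDeg

lemma apply_mem (hτ : TwistingToDeg 𝕜 _ _ (polyGrade 𝕜) (polyGrade 𝕜) τ n) (i j : ℕ) :
    τ (((X : Polynomial 𝕜) ^ i) ⊗ₜ[𝕜] ((X : Polynomial 𝕜) ^ j)) ∈
      kunneth 𝕜 (polyGrade 𝕜) (polyGrade 𝕜) (i + j) :=
  hτ.1 _ ⟨_, X_pow_tmul_mem_kunneth i j, rfl⟩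

lemma apply_one_tmul (hτ : TwistingToDeg 𝕜 _ _ (polyGrade 𝕜) (polyGrade 𝕜) τ n) {i : ℕ}
    (hi : i ≤ n) : τ ((1 : Polynomial 𝕜) ⊗ₜ[𝕜] ((X : Polynomial 𝕜) ^ i)) =
      ((X : Polynomial 𝕜) ^ i) ⊗ₜ[𝕜] (1 : Polynomial 𝕜) :=
  hτ.2.1 i hi _ (X_pow_mem_polyGrade i)

lemma apply_tmul_one (hτ : TwistingToDeg 𝕜 _ _ (polyGrade 𝕜) (polyGrade 𝕜) τ n) {i : ℕ}
    (hi : i ≤ n) : τ (((X : Polynomial 𝕜) ^ i) ⊗ₜ[𝕜] (1 : Polynomial 𝕜)) =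
      (1 : Polynomial 𝕜) ⊗ₜ[𝕜] ((X : Polynomial 𝕜) ^ i) :=
  hτ.2.2.1 i hi _ (X_pow_mem_polyGrade i)

lemma apply_mul_tmul_mul (hτ : TwistingToDeg 𝕜 _ _ (polyGrade 𝕜) (polyGrade 𝕜) τ n)
    {p q r s : ℕ} (h : p + q + (r + s) ≤ n) :
    τ (((X : Polynomial 𝕜) ^ (p + q)) ⊗ₜ[𝕜] ((X : Polynomial 𝕜) ^ (r + s))) =
      twistRHS 𝕜 _ _ τ ((((X : Polynomial 𝕜) ^ p) ⊗ₜ[𝕜] ((X : Polynomial 𝕜) ^ q)) ⊗ₜ[𝕜]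
        (((X : Polynomial 𝕜) ^ r) ⊗ₜ[𝕜] ((X : Polynomial 𝕜) ^ s))) := by
  rw [← hτ.2.2.2 _ h _
    (tmul_mem_kunneth (X_pow_tmul_mem_kunneth p q) (X_pow_tmul_mem_kunneth r s))]
  simp only [twistLHS, LinearMap.comp_apply, TensorProduct.map_tmul, LinearMap.mul'_apply, pow_add]

lemma mulTau_tmul_one_tmul (hτ : TwistingToDeg 𝕜 _ _ (polyGrade 𝕜) (polyGrade 𝕜) τ n)
    {d : ℕ} (hd : d ≤ n) (p : Polynomial 𝕜) {w : Polynomial 𝕜 ⊗[𝕜] Polynomial 𝕜}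
    (hw : w ∈ kunneth 𝕜 (polyGrade 𝕜) (polyGrade 𝕜) d) :
    mulTau 𝕜 _ _ τ ((p ⊗ₜ[𝕜] 1) ⊗ₜ[𝕜] w) = (p ⊗ₜ[𝕜] 1) * w := by
  obtain ⟨t, -, rfl⟩ := exists_eq_sum_of_mem_kunneth hw
  simp only [TensorProduct.tmul_sum, map_sum, Finset.mul_sum, TensorProduct.tmul_smul, map_smul,
    mul_smul_comm]
  refine Finset.sum_congr rfl fun k hk => ?_
  simp [mulTau, -Algebra.TensorProduct.tmul_pow, hτ.apply_one_tmul (i := d - k) (by omega)]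

lemma mulTau_tmul_tmul_one_tmul (hτ : TwistingToDeg 𝕜 _ _ (polyGrade 𝕜) (polyGrade 𝕜) τ n)
    {d : ℕ} (hd : d ≤ n) (p : Polynomial 𝕜) {w : Polynomial 𝕜 ⊗[𝕜] Polynomial 𝕜}
    (hw : w ∈ kunneth 𝕜 (polyGrade 𝕜) (polyGrade 𝕜) d) :
    mulTau 𝕜 _ _ τ (w ⊗ₜ[𝕜] (1 ⊗ₜ[𝕜] p)) = w * (1 ⊗ₜ[𝕜] p) := by
  obtain ⟨t, -, rfl⟩ := exists_eq_sum_of_mem_kunneth hw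
  simp only [TensorProduct.sum_tmul, map_sum, Finset.sum_mul, ← TensorProduct.smul_tmul', map_smul,
    smul_mul_assoc]
  refine Finset.sum_congr rfl fun k hk => ?_
  have hk' : k ≤ n := by simp at hk; omega
  simp [mulTau, -Algebra.TensorProduct.tmul_pow, hτ.apply_tmul_one hk']

/-- Moving `y^j` past `x` first and the result past `x^s` afterwards. -/
lemma apply_X_pow_tmul_X_pow_add (hτ : TwistingToDeg 𝕜 _ _ (polyGrade 𝕜) (polyGrade 𝕜) τ n)
    {j s : ℕ} (hn : j + 1 + s ≤ n) {t : ℕ → 𝕜}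
    (ht : τ (((X : Polynomial 𝕜) ^ j) ⊗ₜ[𝕜] (X : Polynomial 𝕜)) =
      ∑ k ∈ Finset.range (j + 1 + 1),
        t k • (((X : Polynomial 𝕜) ^ (j + 1 - k)) ⊗ₜ[𝕜] ((X : Polynomial 𝕜) ^ k))) :
    τ (((X : Polynomial 𝕜) ^ j) ⊗ₜ[𝕜] ((X : Polynomial 𝕜) ^ (1 + s))) =
      ∑ k ∈ Finset.range (j + 1 + 1),
        t k • ((((X : Polynomial 𝕜) ^ (j + 1 - k)) ⊗ₜ[𝕜] 1) *
          τ (((X : Polynomial 𝕜) ^ k) ⊗ₜ[𝕜] ((X : Polynomial 𝕜) ^ s))) := by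
  have h := hτ.apply_mul_tmul_mul (p := 0) (q := j) (r := 1) (s := s) (by omega)
  rw [pow_one, twistRHS_tmul ht, zero_add] at h
  rw [h]
  refine Finset.sum_congr rfl fun k hk => ?_
  have hk' : k ≤ j + 1 := by simp at hk; omega
  rw [pow_zero, hτ.apply_one_tmul (by omega),
    hτ.mulTau_tmul_one_tmul (d := k + s) (by omega) _ (hτ.apply_mem k s)]

/-- Moving `y` past `x` first and `y^q` past the result afterwards. -/
lemma apply_X_pow_succ_tmul_X (hτ : TwistingToDeg 𝕜 _ _ (polyGrade 𝕜) (polyGrade 𝕜) τ n)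
    {q : ℕ} (hn : q + 2 ≤ n) {a b c : 𝕜}
    (hyx : τ ((X : Polynomial 𝕜) ⊗ₜ[𝕜] (X : Polynomial 𝕜)) =
      a • (((X : Polynomial 𝕜) ^ 2) ⊗ₜ[𝕜] (1 : Polynomial 𝕜)) +
      b • ((X : Polynomial 𝕜) ⊗ₜ[𝕜] (X : Polynomial 𝕜)) +
      c • ((1 : Polynomial 𝕜) ⊗ₜ[𝕜] ((X : Polynomial 𝕜) ^ 2))) :
    τ (((X : Polynomial 𝕜) ^ (q + 1)) ⊗ₜ[𝕜] (X : Polynomial 𝕜)) =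
      a • τ (((X : Polynomial 𝕜) ^ q) ⊗ₜ[𝕜] ((X : Polynomial 𝕜) ^ 2)) +
      b • (τ (((X : Polynomial 𝕜) ^ q) ⊗ₜ[𝕜] (X : Polynomial 𝕜)) * (1 ⊗ₜ[𝕜] X)) +
      c • ((1 : Polynomial 𝕜) ⊗ₜ[𝕜] ((X : Polynomial 𝕜) ^ (q + 2))) := by
  let t : ℕ → 𝕜 := fun k => if k = 0 then a else if k = 1 then b else c
  have ht : τ (((X : Polynomial 𝕜) ^ 1) ⊗ₜ[𝕜] ((X : Polynomial 𝕜) ^ 1)) =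
      ∑ k ∈ Finset.range 3,
        t k • (((X : Polynomial 𝕜) ^ (2 - k)) ⊗ₜ[𝕜] ((X : Polynomial 𝕜) ^ k)) := by
    simp [Finset.sum_range_succ, t, hyx, -Algebra.TensorProduct.tmul_pow]
  have h := hτ.apply_mul_tmul_mul (p := q) (q := 1) (r := 1) (s := 0) (by omega)
  rw [twistRHS_tmul ht] at h
  rw [← pow_one (X : Polynomial 𝕜), ← pow_mul, one_mul]
  rw [h]
  have key : ∀ k ∈ Finset.range 3, mulTau 𝕜 _ _ τ
      (τ (((X : Polynomial 𝕜) ^ q) ⊗ₜ[𝕜] ((X : Polynomial 𝕜) ^ (2 - k))) ⊗ₜ[𝕜]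
        τ (((X : Polynomial 𝕜) ^ k) ⊗ₜ[𝕜] ((X : Polynomial 𝕜) ^ 0))) =
      τ (((X : Polynomial 𝕜) ^ q) ⊗ₜ[𝕜] ((X : Polynomial 𝕜) ^ (2 - k))) *
        (1 ⊗ₜ[𝕜] ((X : Polynomial 𝕜) ^ k)) := by
    intro k hk
    have hk' : k < 3 := by simpa using hk
    rw [pow_zero, hτ.apply_tmul_one (by omega),
      hτ.mulTau_tmul_tmul_one_tmul (d := q + (2 - k)) (by omega) _ (hτ.apply_mem _ _)]
  rw [Finset.sum_congr rfl fun k hk => by rw [key k hk]]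
  simp [Finset.sum_range_succ, t, -Algebra.TensorProduct.tmul_pow, hτ.apply_tmul_one (i := q)
    (by omega), ← Algebra.TensorProduct.one_def, pow_add]

end TwistingToDeg

/-- The coefficient of `1 ⊗ y^(j+1)` in `τ (y^j ⊗ x)`. -/
def topCoeff (τ : Polynomial 𝕜 ⊗[𝕜] Polynomial 𝕜 →ₗ[𝕜] Polynomial 𝕜 ⊗[𝕜] Polynomial 𝕜)
    (j : ℕ) : 𝕜 :=
  evalZeroOne 𝕜 (τ (((X : Polynomial 𝕜) ^ j) ⊗ₜ[𝕜] (X : Polynomial 𝕜)))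

lemma TwistingToDeg.exists_expansion
    (hτ : TwistingToDeg 𝕜 _ _ (polyGrade 𝕜) (polyGrade 𝕜) τ n) (j : ℕ) :
    ∃ t : ℕ → 𝕜, t (j + 1) = topCoeff τ j ∧
      τ (((X : Polynomial 𝕜) ^ j) ⊗ₜ[𝕜] (X : Polynomial 𝕜)) =
        ∑ k ∈ Finset.range (j + 1 + 1),
          t k • (((X : Polynomial 𝕜) ^ (j + 1 - k)) ⊗ₜ[𝕜] ((X : Polynomial 𝕜) ^ k)) := by
  have h := hτ.apply_mem j 1
  rw [pow_one] at h
  exact exists_eq_sum_of_mem_kunneth h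

lemma IsGradedTwisting.topCoeff_succ
    (hτ : IsGradedTwisting 𝕜 _ _ (polyGrade 𝕜) (polyGrade 𝕜) τ) {a b c : 𝕜}
    (hyx : τ ((X : Polynomial 𝕜) ⊗ₜ[𝕜] (X : Polynomial 𝕜)) =
      a • (((X : Polynomial 𝕜) ^ 2) ⊗ₜ[𝕜] (1 : Polynomial 𝕜)) +
      b • ((X : Polynomial 𝕜) ⊗ₜ[𝕜] (X : Polynomial 𝕜)) +
      c • ((1 : Polynomial 𝕜) ⊗ₜ[𝕜] ((X : Polynomial 𝕜) ^ 2))) (j : ℕ) :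
    topCoeff τ (j + 1) = a * (topCoeff τ j * topCoeff τ (j + 1)) + b * topCoeff τ j + c := by
  have h₂ : evalZeroOne 𝕜 (τ (((X : Polynomial 𝕜) ^ j) ⊗ₜ[𝕜] ((X : Polynomial 𝕜) ^ 2))) =
      topCoeff τ j * topCoeff τ (j + 1) := by
    obtain ⟨t, htop, ht⟩ := (hτ.twistingToDeg 0).exists_expansion j
    have h := (hτ.twistingToDeg (j + 1 + 1)).apply_X_pow_tmul_X_pow_add (s := 1) le_rfl ht
    rw [show 2 = 1 + 1 from rfl, h, map_sum, Finset.sum_range_succ, Finset.sum_eq_zero]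
    · rw [htop, map_smul, map_mul, pow_one, ← topCoeff]
      simp [evalZeroOne]
    · intro k hk
      have : j + 1 - k ≠ 0 := by simp at hk; omega
      rw [map_smul, map_mul, ← pow_zero (X : Polynomial 𝕜), evalZeroOne_X_pow_tmul, if_neg this]
      simp
  have h := congrArg (evalZeroOne 𝕜)
    ((hτ.twistingToDeg (j + 2)).apply_X_pow_succ_tmul_X le_rfl hyx)
  rw [map_add, map_add, map_smul, map_smul, map_smul, h₂, map_mul, ← topCoeff, ← topCoeff] at h
  have h₁ (k : ℕ) : evalZeroOne 𝕜 (1 ⊗ₜ[𝕜] ((X : Polynomial 𝕜) ^ k)) = 1 := by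
    simp [evalZeroOne]
  have h₁X : evalZeroOne 𝕜 (1 ⊗ₜ[𝕜] (X : Polynomial 𝕜)) = 1 := by simp [evalZeroOne]
  rwa [h₁, h₁X, mul_one, smul_eq_mul, smul_eq_mul, smul_eq_mul, mul_one] at h

lemma IsGradedTwisting.one_sub_mul_topCoeff_ne_zero
    (hτ : IsGradedTwisting 𝕜 _ _ (polyGrade 𝕜) (polyGrade 𝕜) τ) {a b c : 𝕜}
    (hyx : τ ((X : Polynomial 𝕜) ⊗ₜ[𝕜] (X : Polynomial 𝕜)) =
      a • (((X : Polynomial 𝕜) ^ 2) ⊗ₜ[𝕜] (1 : Polynomial 𝕜)) +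
      b • ((X : Polynomial 𝕜) ⊗ₜ[𝕜] (X : Polynomial 𝕜)) +
      c • ((1 : Polynomial 𝕜) ⊗ₜ[𝕜] ((X : Polynomial 𝕜) ^ 2)))
    (h : 1 - a * c ≠ 0) (j : ℕ) : 1 - a * topCoeff τ j ≠ 0 := by
  intro hj
  have hrec := hτ.topCoeff_succ hyx
  have h₀ : topCoeff τ 0 = 0 := by
    rw [topCoeff, pow_zero, hτ.1.1]
    simp [evalZeroOne]
  have hcb : c + b * topCoeff τ j = 0 := by
    linear_combination topCoeff τ (j + 1) * hj - hrec j
  have hb : b = -(a * c) := by linear_combination b * hj + a * hcb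
  have hc : ∀ i, topCoeff τ (i + 1) = c := by
    intro i
    induction i with
    | zero => rw [hrec, h₀]; ring
    | succ i ih =>
      refine mul_left_cancel₀ h ?_
      have := hrec (i + 1)
      rw [ih, hb] at this
      linear_combination this
  cases j with
  | zero => simp [h₀] at hj
  | succ i => exact h (hc i ▸ hj)

lemma eq_zero_of_chain {M : Type} [AddCommGroup M] [Module 𝕜 M] {m : ℕ} {a : 𝕜} {γ : ℕ → 𝕜}
    {δ : ℕ → M} (hγ : 1 - a * γ m ≠ 0) (hδ : ∀ j, 1 ≤ j → j ≤ m → δ j = γ j • δ (j + 1))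
    (htop : δ (m + 1) = a • δ m) (hm : 1 ≤ m) {j : ℕ} (hj : 1 ≤ j) (hjm : j ≤ m + 1) :
    δ j = 0 := by
  have h₀ : δ (m + 1) = 0 := by
    have h : (1 - a * γ m) • δ (m + 1) = 0 := by
      rw [sub_smul, one_smul, mul_smul, ← hδ m hm le_rfl, ← htop, sub_self]
    exact (smul_eq_zero.1 h).resolve_left hγ
  induction hjm using Nat.decreasingInduction with
  | self => exact h₀
  | of_succ k hk ih => rw [hδ k hj (by omega), ih (by omega), smul_zero]

end Twisting

section UniqueExtension

variable {𝕜 : Type} [Field 𝕜] {a b c : 𝕜}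
  {τ : Polynomial 𝕜 ⊗[𝕜] Polynomial 𝕜 →ₗ[𝕜] Polynomial 𝕜 ⊗[𝕜] Polynomial 𝕜}

lemma IsGradedTwisting.uep (hτ : IsGradedTwisting 𝕜 _ _ (polyGrade 𝕜) (polyGrade 𝕜) τ)
    (hyx : τ ((X : Polynomial 𝕜) ⊗ₜ[𝕜] (X : Polynomial 𝕜)) =
      a • (((X : Polynomial 𝕜) ^ 2) ⊗ₜ[𝕜] (1 : Polynomial 𝕜)) +
      b • ((X : Polynomial 𝕜) ⊗ₜ[𝕜] (X : Polynomial 𝕜)) +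
      c • ((1 : Polynomial 𝕜) ⊗ₜ[𝕜] ((X : Polynomial 𝕜) ^ 2)))
    (h : 1 - a * c ≠ 0) : UEP 𝕜 _ _ (polyGrade 𝕜) (polyGrade 𝕜) τ := by
  intro n hn τ' hτ' hlt x hx
  obtain ⟨m, rfl⟩ : ∃ m, n = m + 2 := ⟨n - 2, by omega⟩
  have hτn := hτ.twistingToDeg (m + 2)
  have hlow : ∀ i j, i + j < m + 2 →
      τ' (((X : Polynomial 𝕜) ^ i) ⊗ₜ[𝕜] ((X : Polynomial 𝕜) ^ j)) =
        τ (((X : Polynomial 𝕜) ^ i) ⊗ₜ[𝕜] ((X : Polynomial 𝕜) ^ j)) :=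
    fun i j hij => hlt _ hij _ (X_pow_tmul_mem_kunneth i j)
  have hlow₁ : ∀ i, i + 1 < m + 2 →
      τ' (((X : Polynomial 𝕜) ^ i) ⊗ₜ[𝕜] (X : Polynomial 𝕜)) =
        τ (((X : Polynomial 𝕜) ^ i) ⊗ₜ[𝕜] (X : Polynomial 𝕜)) := by
    intro i hi
    simpa only [pow_one] using hlow i 1 hi
  let δ : ℕ → Polynomial 𝕜 ⊗[𝕜] Polynomial 𝕜 := fun j =>
    τ' (((X : Polynomial 𝕜) ^ j) ⊗ₜ[𝕜] ((X : Polynomial 𝕜) ^ (m + 2 - j))) -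
      τ (((X : Polynomial 𝕜) ^ j) ⊗ₜ[𝕜] ((X : Polynomial 𝕜) ^ (m + 2 - j)))
  have hchain : ∀ j, 1 ≤ j → j ≤ m → δ j = topCoeff τ j • δ (j + 1) := by
    intro j hj hjm
    obtain ⟨t, htop, ht⟩ := hτn.exists_expansion j
    have hs : j + 1 + (m + 1 - j) ≤ m + 2 := by omega
    simp only [δ]
    rw [show m + 2 - j = 1 + (m + 1 - j) by omega, show m + 2 - (j + 1) = m + 1 - j by omega,
      hτn.apply_X_pow_tmul_X_pow_add hs ht,
      hτ'.apply_X_pow_tmul_X_pow_add hs ((hlow₁ j (by omega)).trans ht),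
      ← Finset.sum_sub_distrib, Finset.sum_range_succ, Finset.sum_eq_zero]
    · simp [htop, smul_sub, ← Algebra.TensorProduct.one_def, -Algebra.TensorProduct.tmul_pow]
    · intro k hk
      have hk' : k < j + 1 := by simpa using hk
      rw [hlow k _ (by omega), sub_self]
  have htop : δ (m + 1) = a • δ m := by
    have h₁ := hτn.apply_X_pow_succ_tmul_X le_rfl hyx
    have h₂ := hτ'.apply_X_pow_succ_tmul_X le_rfl ((by simpa using hlow₁ 1 (by omega) :
      τ' (X ⊗ₜ[𝕜] X) = τ (X ⊗ₜ[𝕜] X)).trans hyx)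
    simp only [δ]
    rw [show m + 2 - (m + 1) = 1 by omega, show m + 2 - m = 2 by omega, pow_one, h₁, h₂,
      hlow₁ m (by omega), smul_sub]
    abel
  have hle : kunneth 𝕜 (polyGrade 𝕜) (polyGrade 𝕜) (m + 2) ≤ LinearMap.eqLocus τ' τ := by
    refine kunneth_polyGrade_le fun i j hij => ?_
    rw [LinearMap.mem_eqLocus]
    rcases Nat.eq_zero_or_pos i with rfl | hi
    · rw [pow_zero, hτ'.apply_one_tmul (by omega), hτn.apply_one_tmul (by omega)]
    rcases Nat.eq_zero_or_pos j with rfl | hj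
    · rw [pow_zero, hτ'.apply_tmul_one (by omega), hτn.apply_tmul_one (by omega)]
    have := eq_zero_of_chain (δ := δ) (hτ.one_sub_mul_topCoeff_ne_zero hyx h m) hchain htop (by omega)
      (j := i) hi (by omega)
    simpa only [δ, show m + 2 - i = j by omega, sub_eq_zero] using this
  exact hle hx

end UniqueExtension

section Quadratic

variable {𝕜 : Type} [Field 𝕜]

lemma mul_mem_idealSpan {C : Type} [Ring C] [Algebra 𝕜 C] {s : Set C} {x : C}
    (hx : x ∈ idealSpan 𝕜 C s) (l r : C) : l * x * r ∈ idealSpan 𝕜 C s := by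
  induction hx using Submodule.span_induction with
  | mem x hx =>
    obtain ⟨c, d, y, hy, rfl⟩ := hx
    exact Submodule.subset_span ⟨l * c, d * r, y, hy, by simp only [mul_assoc]⟩
  | zero => simp
  | add x y _ _ hx hy => rw [mul_add, add_mul]; exact Submodule.add_mem _ hx hy
  | smul k x _ hx => rw [mul_smul_comm, smul_mul_assoc]; exact Submodule.smul_mem _ k hx

lemma subset_idealSpan {C : Type} [Ring C] [Algebra 𝕜 C] {s : Set C} :
    s ⊆ idealSpan 𝕜 C s :=
  fun x hx => Submodule.subset_span ⟨1, 1, x, hx, by simp⟩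

lemma idealSpan_le {C : Type} [Ring C] [Algebra 𝕜 C] {s t : Set C}
    (h : s ⊆ idealSpan 𝕜 C t) : idealSpan 𝕜 C s ≤ idealSpan 𝕜 C t := by
  refine Submodule.span_le.2 ?_
  rintro _ ⟨c, d, r, hr, rfl⟩
  exact mul_mem_idealSpan (h hr) c d

section MulMap

variable {A B P : Type} [CommRing A] [Algebra 𝕜 A] [CommRing B] [Algebra 𝕜 B] [Ring P]
  [Algebra 𝕜 P] (ιA : A →ₐ[𝕜] P) (ιB : B →ₐ[𝕜] P)

@[simp]
lemma mulMapP_tmul (p : A) (q : B) : mulMapP 𝕜 A B P ιA ιB (p ⊗ₜ[𝕜] q) = ιA p * ιB q := by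
  simp [mulMapP]

lemma mulMapP_tmul_one_mul (p : A) (w : A ⊗[𝕜] B) :
    mulMapP 𝕜 A B P ιA ιB ((p ⊗ₜ[𝕜] 1) * w) = ιA p * mulMapP 𝕜 A B P ιA ιB w := by
  induction w with
  | zero => simp
  | add u v hu hv => simp only [mul_add, map_add, hu, hv]
  | tmul u v => simp [mul_assoc]

lemma mulMapP_mul_one_tmul (q : B) (w : A ⊗[𝕜] B) :
    mulMapP 𝕜 A B P ιA ιB (w * (1 ⊗ₜ[𝕜] q)) = mulMapP 𝕜 A B P ιA ιB w * ιB q := by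
  induction w with
  | zero => simp
  | add u v hu hv => simp only [add_mul, map_add, hu, hv]
  | tmul u v => simp [mul_assoc]

/-- The linear map sending `q ⊗ p` to the relation `q ⊗ p - τ (q ⊗ p)` in `P`. -/
def relMap (τ : B ⊗[𝕜] A →ₗ[𝕜] A ⊗[𝕜] B) : B ⊗[𝕜] A →ₗ[𝕜] P :=
  mulMapP 𝕜 B A P ιB ιA - mulMapP 𝕜 A B P ιA ιB ∘ₗ τ

lemma relMap_tmul (τ : B ⊗[𝕜] A →ₗ[𝕜] A ⊗[𝕜] B) (q : B) (p : A) :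
    relMap ιA ιB τ (q ⊗ₜ[𝕜] p) =
      ιB q * ιA p - mulMapP 𝕜 A B P ιA ιB (τ (q ⊗ₜ[𝕜] p)) := by
  simp [relMap]

end MulMap

variable {a b c : 𝕜}
  {τ : Polynomial 𝕜 ⊗[𝕜] Polynomial 𝕜 →ₗ[𝕜] Polynomial 𝕜 ⊗[𝕜] Polynomial 𝕜}
  {P : Type} [Ring P] [Algebra 𝕜 P] (ιA ιB : Polynomial 𝕜 →ₐ[𝕜] P)

lemma IsGradedTwisting.relMap_X_pow_tmul_X_pow_add
    (hτ : IsGradedTwisting 𝕜 _ _ (polyGrade 𝕜) (polyGrade 𝕜) τ) {j : ℕ} (s : ℕ) {t : ℕ → 𝕜}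
    (ht : τ (((X : Polynomial 𝕜) ^ j) ⊗ₜ[𝕜] (X : Polynomial 𝕜)) =
      ∑ k ∈ Finset.range (j + 1 + 1),
        t k • (((X : Polynomial 𝕜) ^ (j + 1 - k)) ⊗ₜ[𝕜] ((X : Polynomial 𝕜) ^ k))) :
    relMap ιA ιB τ (((X : Polynomial 𝕜) ^ j) ⊗ₜ[𝕜] ((X : Polynomial 𝕜) ^ (1 + s))) =
      relMap ιA ιB τ (((X : Polynomial 𝕜) ^ j) ⊗ₜ[𝕜] (X : Polynomial 𝕜)) * ιA (X ^ s) +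
      ∑ k ∈ Finset.range (j + 1 + 1), t k • (ιA (X ^ (j + 1 - k)) *
        relMap ιA ιB τ (((X : Polynomial 𝕜) ^ k) ⊗ₜ[𝕜] ((X : Polynomial 𝕜) ^ s))) := by
  have h := (hτ.twistingToDeg _).apply_X_pow_tmul_X_pow_add (s := s) le_rfl ht
  have hA : ιA (X ^ (1 + s)) = ιA X * ιA (X ^ s) := by rw [pow_add, pow_one, map_mul]
  simp only [relMap_tmul, h, ht, map_sum, map_smul, mulMapP_tmul_one_mul, mulMapP_tmul, mul_sub,
    smul_sub, Finset.sum_sub_distrib, sub_mul, Finset.sum_mul, smul_mul_assoc, hA, mul_assoc]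
  abel

lemma IsGradedTwisting.relMap_X_pow_succ_tmul_X
    (hτ : IsGradedTwisting 𝕜 _ _ (polyGrade 𝕜) (polyGrade 𝕜) τ)
    (hyx : τ ((X : Polynomial 𝕜) ⊗ₜ[𝕜] (X : Polynomial 𝕜)) =
      a • (((X : Polynomial 𝕜) ^ 2) ⊗ₜ[𝕜] (1 : Polynomial 𝕜)) +
      b • ((X : Polynomial 𝕜) ⊗ₜ[𝕜] (X : Polynomial 𝕜)) +
      c • ((1 : Polynomial 𝕜) ⊗ₜ[𝕜] ((X : Polynomial 𝕜) ^ 2))) (q : ℕ) :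
    relMap ιA ιB τ (((X : Polynomial 𝕜) ^ (q + 1)) ⊗ₜ[𝕜] (X : Polynomial 𝕜)) =
      ιB (X ^ q) * relMap ιA ιB τ ((X : Polynomial 𝕜) ⊗ₜ[𝕜] (X : Polynomial 𝕜)) +
      a • relMap ιA ιB τ (((X : Polynomial 𝕜) ^ q) ⊗ₜ[𝕜] ((X : Polynomial 𝕜) ^ 2)) +
      b • (relMap ιA ιB τ (((X : Polynomial 𝕜) ^ q) ⊗ₜ[𝕜] (X : Polynomial 𝕜)) * ιB X) := by
  have h := (hτ.twistingToDeg _).apply_X_pow_succ_tmul_X le_rfl hyx (q := q)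
  have hB : ιB (X ^ (q + 1)) = ιB (X ^ q) * ιB X := by rw [pow_add, pow_one, map_mul]
  have hB' : ιB (X ^ (q + 2)) = ιB (X ^ q) * ιB (X ^ 2) := by rw [pow_add, map_mul]
  simp only [relMap_tmul, h, hyx, map_add, map_smul, mulMapP_mul_one_tmul, mulMapP_tmul, mul_sub,
    smul_sub, sub_mul, mul_add, mul_smul_comm, hB, hB', mul_assoc, map_one, one_mul, mul_one]
  abel

lemma IsGradedTwisting.relMap_mem
    (hτ : IsGradedTwisting 𝕜 _ _ (polyGrade 𝕜) (polyGrade 𝕜) τ)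
    (hyx : τ ((X : Polynomial 𝕜) ⊗ₜ[𝕜] (X : Polynomial 𝕜)) =
      a • (((X : Polynomial 𝕜) ^ 2) ⊗ₜ[𝕜] (1 : Polynomial 𝕜)) +
      b • ((X : Polynomial 𝕜) ⊗ₜ[𝕜] (X : Polynomial 𝕜)) +
      c • ((1 : Polynomial 𝕜) ⊗ₜ[𝕜] ((X : Polynomial 𝕜) ^ 2)))
    (h : 1 - a * c ≠ 0) (n : ℕ) : ∀ j i, j + i = n →
    relMap ιA ιB τ (((X : Polynomial 𝕜) ^ j) ⊗ₜ[𝕜] ((X : Polynomial 𝕜) ^ i)) ∈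
      idealSpan 𝕜 P (relSetLe 𝕜 _ _ P ιA ιB (polyGrade 𝕜) (polyGrade 𝕜) τ 2) := by
  set J := idealSpan 𝕜 P (relSetLe 𝕜 _ _ P ιA ιB (polyGrade 𝕜) (polyGrade 𝕜) τ 2)
  induction n using Nat.strong_induction_on with
  | _ n ih =>
  intro j i hji
  rcases le_or_gt n 2 with hn | hn
  · refine subset_idealSpan ⟨i, j, X ^ i, X ^ j, by omega, X_pow_mem_polyGrade i,
      X_pow_mem_polyGrade j, relMap_tmul ..⟩
  rcases Nat.eq_zero_or_pos j with rfl | hj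
  · rw [relMap_tmul, pow_zero, hτ.1.1]
    simp
  rcases Nat.eq_zero_or_pos i with rfl | hi
  · rw [relMap_tmul, pow_zero, hτ.1.2.1]
    simp
  obtain ⟨m, rfl⟩ : ∃ m, n = m + 2 := ⟨n - 2, by omega⟩
  have hlow : ∀ p q, p + q < m + 2 →
      relMap ιA ιB τ (((X : Polynomial 𝕜) ^ p) ⊗ₜ[𝕜] ((X : Polynomial 𝕜) ^ q)) ∈ J :=
    fun p q hpq => ih _ hpq p q rfl
  have hlow₁ : ∀ p, p + 1 < m + 2 →
      relMap ιA ιB τ (((X : Polynomial 𝕜) ^ p) ⊗ₜ[𝕜] (X : Polynomial 𝕜)) ∈ J := by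
    intro p hp
    simpa only [pow_one] using hlow p 1 hp
  have hl : ∀ l x, x ∈ J → l * x ∈ J := fun l x hx => by
    simpa using mul_mem_idealSpan hx l 1
  have hr : ∀ r x, x ∈ J → x * r ∈ J := fun r x hx => by
    simpa using mul_mem_idealSpan hx 1 r
  let δ : ℕ → P ⧸ J := fun j => J.mkQ
    (relMap ιA ιB τ (((X : Polynomial 𝕜) ^ j) ⊗ₜ[𝕜] ((X : Polynomial 𝕜) ^ (m + 2 - j))))
  have hchain : ∀ j, 1 ≤ j → j ≤ m → δ j = topCoeff τ j • δ (j + 1) := by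
    intro j hj hjm
    obtain ⟨t, htop, ht⟩ := (hτ.twistingToDeg 0).exists_expansion j
    simp only [δ]
    rw [show m + 2 - j = 1 + (m + 1 - j) by omega, show m + 2 - (j + 1) = m + 1 - j by omega,
      hτ.relMap_X_pow_tmul_X_pow_add ιA ιB _ ht, ← map_smul J.mkQ, ← sub_eq_zero, ← map_sub,
      Submodule.mkQ_apply, Submodule.Quotient.mk_eq_zero, Finset.sum_range_succ, htop]
    rw [Nat.sub_self, pow_zero, map_one, one_mul, ← add_assoc, add_sub_cancel_right]
    refine J.add_mem (hr _ _ (hlow₁ j (by omega))) (J.sum_mem fun k hk => ?_)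
    have hk' : k < j + 1 := by simpa using hk
    exact J.smul_mem _ (hl _ _ (hlow k _ (by omega)))
  have htop : δ (m + 1) = a • δ m := by
    simp only [δ]
    rw [show m + 2 - (m + 1) = 1 by omega, show m + 2 - m = 2 by omega, pow_one,
      hτ.relMap_X_pow_succ_tmul_X ιA ιB hyx, ← map_smul J.mkQ, ← sub_eq_zero, ← map_sub,
      Submodule.mkQ_apply, Submodule.Quotient.mk_eq_zero, add_right_comm, add_sub_cancel_right]
    refine J.add_mem (hl _ _ ?_) (J.smul_mem _ (hr _ _ (hlow₁ m (by omega))))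
    simpa only [pow_one] using hlow₁ 1 (by omega)
  have := eq_zero_of_chain (δ := δ) (hτ.one_sub_mul_topCoeff_ne_zero hyx h m) hchain htop (by omega)
    hj (by omega)
  simpa only [δ, show m + 2 - j = i by omega, Submodule.mkQ_apply,
    Submodule.Quotient.mk_eq_zero] using this

lemma IsGradedTwisting.idealSpan_relSetAll
    (hτ : IsGradedTwisting 𝕜 _ _ (polyGrade 𝕜) (polyGrade 𝕜) τ)
    (hyx : τ ((X : Polynomial 𝕜) ⊗ₜ[𝕜] (X : Polynomial 𝕜)) =
      a • (((X : Polynomial 𝕜) ^ 2) ⊗ₜ[𝕜] (1 : Polynomial 𝕜)) +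
      b • ((X : Polynomial 𝕜) ⊗ₜ[𝕜] (X : Polynomial 𝕜)) +
      c • ((1 : Polynomial 𝕜) ⊗ₜ[𝕜] ((X : Polynomial 𝕜) ^ 2)))
    (h : 1 - a * c ≠ 0) :
    idealSpan 𝕜 P (relSetAll 𝕜 _ _ P ιA ιB τ) =
      idealSpan 𝕜 P (relSetLe 𝕜 _ _ P ιA ιB (polyGrade 𝕜) (polyGrade 𝕜) τ 2) := by
  apply le_antisymm
  · refine idealSpan_le ?_
    rintro _ ⟨p, q, rfl⟩
    rw [SetLike.mem_coe, ← relMap_tmul]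
    induction q using Polynomial.induction_on' with
    | add q q' hq hq' => rw [TensorProduct.add_tmul, map_add]; exact Submodule.add_mem _ hq hq'
    | monomial j s =>
    induction p using Polynomial.induction_on' with
    | add p p' hp hp' => rw [TensorProduct.tmul_add, map_add]; exact Submodule.add_mem _ hp hp'
    | monomial i r =>
    rw [← Polynomial.smul_X_eq_monomial, ← Polynomial.smul_X_eq_monomial,
      ← TensorProduct.smul_tmul', TensorProduct.tmul_smul, map_smul, map_smul]
    exact Submodule.smul_mem _ _ (Submodule.smul_mem _ _
      (hτ.relMap_mem ιA ιB hyx h _ j i rfl))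
  · refine idealSpan_le fun x hx => subset_idealSpan ?_
    obtain ⟨_, _, p, q, -, -, -, hx⟩ := hx
    exact ⟨p, q, hx⟩

end Quadratic

/-- Theorem 6.3 (`abcTheorem`).  Let `A = 𝕜[x]`, `B = 𝕜[y]` and let `τ : B ⊗ A → A ⊗ B`
be a graded twisting map with `τ(y ⊗ x) = a x² ⊗ 1 + b x ⊗ y + c 1 ⊗ y²`.  If
`1 - ac ≠ 0` then `τ` has the unique extension property and `A ⊗_τ B` is `τ`-quadratic
(in any free product `P = A * B`, the ideal generated by all `τ`-relations equals the
ideal generated by the `τ`-relations of degree at most 2). -/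
theorem stmt16 (𝕜 : Type) [Field 𝕜] (a b c : 𝕜)
    (τ : (Polynomial 𝕜) ⊗[𝕜] (Polynomial 𝕜) →ₗ[𝕜] (Polynomial 𝕜) ⊗[𝕜] (Polynomial 𝕜))
    (hτ : IsGradedTwisting 𝕜 (Polynomial 𝕜) (Polynomial 𝕜) (polyGrade 𝕜) (polyGrade 𝕜) τ)
    (hyx : τ ((X : Polynomial 𝕜) ⊗ₜ[𝕜] (X : Polynomial 𝕜)) =
      a • (((X : Polynomial 𝕜) ^ 2) ⊗ₜ[𝕜] (1 : Polynomial 𝕜)) +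
      b • ((X : Polynomial 𝕜) ⊗ₜ[𝕜] (X : Polynomial 𝕜)) +
      c • ((1 : Polynomial 𝕜) ⊗ₜ[𝕜] ((X : Polynomial 𝕜) ^ 2)))
    (h : 1 - a * c ≠ 0) :
    UEP 𝕜 (Polynomial 𝕜) (Polynomial 𝕜) (polyGrade 𝕜) (polyGrade 𝕜) τ ∧
    (∀ (P : Type) [Ring P] [Algebra 𝕜 P],
      ∀ (ιA ιB : Polynomial 𝕜 →ₐ[𝕜] P),
        IsFreeProduct 𝕜 (Polynomial 𝕜) (Polynomial 𝕜) P ιA ιB →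
        idealSpan 𝕜 P (relSetAll 𝕜 (Polynomial 𝕜) (Polynomial 𝕜) P ιA ιB τ) =
          idealSpan 𝕜 P
            (relSetLe 𝕜 (Polynomial 𝕜) (Polynomial 𝕜) P ιA ιB
              (polyGrade 𝕜) (polyGrade 𝕜) τ 2)) := by
  exact ⟨hτ.uep hyx h, fun P _ _ ιA ιB _ => hτ.idealSpan_relSetAll ιA ιB hyx h⟩

end TTP
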